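/- Fix an integer k ≥ 4 and a real c ∈ (2/k, 1), and set α_k = e·k^{−k/(k−2)}. There exists ε > 0 such that for every α ∈ [0.99·α_k, 1/2], taking ζ₁ = α and ζ₂ = 1 − α gives H_k(α, (α, 1−α); c) ≤ −ε. -/

import Mathlib

/-- `f(x) = e^x - 1 - x`. -/
noncomputable def fEx (x : ℝ) : ℝ := Real.exp x - 1 - x

/-- `ψ(x) = x (e^x - 1) / (e^x - 1 - x)` for `x ≠ 0`, extended by `ψ(0) = 2`. -/
noncomputable def psi (x : ℝ) : ℝ :=
  if x = 0 then 2 else x * (Real.exp x - 1) / (Real.exp x - 1 - x)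

/-- The entropy function `H(α) = -α ln α - (1-α) ln(1-α)`. -/
noncomputable def Hent (a : ℝ) : ℝ := -(a * Real.log a) - (1 - a) * Real.log (1 - a)

/-- `H_k(α, (ζ₁,ζ₂); c)` with `λ` the positive root of `ψ(λ) = ck` passed explicitly. -/
noncomputable def HkF (k : ℕ) (a z1 z2 c lam : ℝ) : ℝ :=
  c * Hent a + c * k * a * Real.log (a / z1) + c * k * (1 - a) * Real.log ((1 - a) / z2)
    + Real.log ((fEx (lam * (z2 + z1)) + fEx (lam * (z2 - z1))) / (2 * fEx lam))

/-- `α_k = e k^{-k/(k-2)}`. -/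
noncomputable def alphaK (k : ℕ) : ℝ :=
  Real.exp 1 * (k : ℝ) ^ (-(k : ℝ) / ((k : ℝ) - 2))

lemma aux_f_pos (x : ℝ) (hx : 0 < x) : 0 < fEx x := by
  have := Real.add_one_lt_exp hx.ne'
  unfold fEx; linarith

lemma aux_f_nonneg (x : ℝ) : 0 ≤ fEx x := by
  have := Real.add_one_le_exp x
  unfold fEx; linarith

lemma aux_f_hasSum (x : ℝ) :
    HasSum (fun n : ℕ => x ^ (n + 2) / ((n + 2).factorial : ℝ)) (fEx x) := by
  have h := NormedSpace.expSeries_div_hasSum_exp x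
  rw [← Real.exp_eq_exp_ℝ] at h
  have h2 := (hasSum_nat_add_iff' 2).2 h
  simpa [fEx, Finset.sum_range_succ, sub_sub] using h2

lemma aux_f_scale (s x : ℝ) (hs : 0 ≤ s) (hs1 : s ≤ 1) (hx : 0 ≤ x) :
    fEx (s * x) ≤ s ^ 2 * fEx x := by
  refine hasSum_le (fun n => ?_) (aux_f_hasSum (s * x)) ((aux_f_hasSum x).mul_left (s ^ 2))
  have h1 : s ^ n ≤ 1 := pow_le_one₀ hs hs1
  have h2 : (s * x) ^ (n + 2) / ((n + 2).factorial : ℝ)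
      = s ^ n * (s ^ 2 * (x ^ (n + 2) / ((n + 2).factorial : ℝ))) := by
    rw [mul_pow, pow_add s]; ring
  rw [h2]
  exact mul_le_of_le_one_left (by positivity) h1

lemma aux_f_lower (x : ℝ) (hx : 0 ≤ x) : x ^ 2 / 2 + x ^ 3 / 6 + x ^ 4 / 24 ≤ fEx x := by
  have h := Real.sum_le_exp_of_nonneg hx 5
  simp [Finset.sum_range_succ, Nat.factorial] at h
  unfold fEx; linarith

lemma aux_f_half (b y : ℝ) (hy : b ^ 2 / 4 ≤ (b - 1) + (b - 2) * y) :
    b * fEx y ≤ fEx (2 * y) := by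
  have : Real.exp (2 * y) = Real.exp y ^ 2 := by rw [two_mul, Real.exp_add]; ring
  unfold fEx
  rw [this]
  nlinarith [sq_nonneg (Real.exp y - b / 2)]

lemma aux_psi (l : ℝ) (hl : 0 < l) : psi l * fEx l = l * (Real.exp l - 1) := by
  have := aux_f_pos l hl
  unfold psi
  rw [if_neg hl.ne']
  unfold fEx at *
  field_simp

lemma aux_psi_le (l T : ℝ) (hl : 0 < l) (h : 2 ≤ (T - l) * (1 + l / 3 + l ^ 2 / 12))
    : psi l ≤ T := by
  have h1 := aux_psi l hl
  have h2 := aux_f_pos l hl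
  have h3 := aux_f_lower l hl.le
  have h4 : psi l * fEx l = l * fEx l + l ^ 2 := by rw [h1]; unfold fEx; ring
  have h5 : 0 ≤ T - l := by
    by_contra hh
    push Not at hh
    have : 0 < 1 + l / 3 + l ^ 2 / 12 := by positivity
    nlinarith
  have h6 : l ^ 2 ≤ (T - l) * fEx l := by
    have := mul_le_mul_of_nonneg_left h3 h5
    nlinarith [mul_le_mul_of_nonneg_left h (by positivity : 0 ≤ l ^ 2 / 2)]
  by_contra hh
  push Not at hh
  nlinarith

lemma aux_f_exp (l x : ℝ) (hl : 0 < l) (hx : 0 ≤ x) (hx1 : x ≤ 1) :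
    fEx (l * x) ≤ fEx l * Real.exp (-(psi l * (1 - x))) := by
  set m := (Real.exp l - 1) / fEx l with hm
  have hfp := aux_f_pos l hl
  have hpm : psi l = l * m := by
    rw [hm]; field_simp; exact aux_psi l hl
  have hmf : m * fEx l = Real.exp l - 1 := by rw [hm]; field_simp
  have key : MonotoneOn (fun u => fEx u * Real.exp (-(m * u))) (Set.Icc 0 l) := by
    have hd : ∀ u : ℝ, HasDerivAt (fun u => fEx u * Real.exp (-(m * u)))
        ((Real.exp u - 1) * Real.exp (-(m * u)) + fEx u * (Real.exp (-(m * u)) * (-m))) u := by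
      intro u
      have h1 : HasDerivAt fEx (Real.exp u - 1) u := by
        have := ((Real.hasDerivAt_exp u).sub_const 1).sub (hasDerivAt_id u)
        exact this
      have h2 : HasDerivAt (fun u : ℝ => -(m * u)) (-m) u := by
        exact (((hasDerivAt_id u).const_mul m).neg).congr_deriv (by simp)
      exact h1.mul h2.exp
    apply monotoneOn_of_deriv_nonneg (convex_Icc 0 l)
    · exact fun u _ => (hd u).continuousAt.continuousWithinAt
    · exact fun u _ => (hd u).differentiableAt.differentiableWithinAt
    · intro u hu
      rw [interior_Icc] at hu
      rw [(hd u).deriv]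
      have hcx := (convexOn_exp.2 (Set.mem_univ (0:ℝ)) (Set.mem_univ l)
        (show (0:ℝ) ≤ 1 - u / l by
          rw [sub_nonneg, div_le_one hl]; exact hu.2.le) (div_nonneg hu.1.le hl.le)
        (show (1 - u / l) + u / l = 1 by ring))
      simp only [smul_eq_mul, mul_zero, zero_add, Real.exp_zero, mul_one] at hcx
      rw [div_mul_cancel₀ _ hl.ne'] at hcx
      have h3 : l * (Real.exp u - 1) ≤ u * (Real.exp l - 1) := by
        have := mul_le_mul_of_nonneg_left hcx hl.le
        have e : l * (1 - u / l + u / l * Real.exp l) = l - u + u * Real.exp l := by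
          field_simp
        rw [e] at this; linarith
      have h4 : 0 ≤ (Real.exp u - 1) - m * fEx u := by
        have : 0 ≤ ((Real.exp u - 1) - m * fEx u) * fEx l := by
          have e : ((Real.exp u - 1) - m * fEx u) * fEx l
             = u * (Real.exp l - 1) - l * (Real.exp u - 1) := by
            have : ((Real.exp u - 1) - m * fEx u) * fEx l
              = (Real.exp u - 1) * fEx l - fEx u * (m * fEx l) := by ring
            rw [this, hmf]; unfold fEx; ring
          rw [e]; linarith
        exact nonneg_of_mul_nonneg_left this hfp
      have := mul_nonneg h4 (Real.exp_pos (-(m * u))).le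
      linarith
  have h := key (a := l * x) ⟨by positivity, by nlinarith⟩ (b := l) ⟨hl.le, le_rfl⟩ (by nlinarith)
  simp only at h
  have e1 : Real.exp (-(psi l * (1 - x))) = Real.exp (-(m * l)) * Real.exp (m * (l * x)) := by
    rw [← Real.exp_add, hpm]; ring_nf
  have e2 : Real.exp (-(m * (l * x))) * Real.exp (m * (l * x)) = 1 := by
    rw [← Real.exp_add]; simp
  rw [e1]
  calc fEx (l * x) = fEx (l*x) * Real.exp (-(m * (l * x))) * Real.exp (m * (l * x)) := by
        rw [mul_assoc, e2, mul_one]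
    _ ≤ fEx l * Real.exp (-(m * l)) * Real.exp (m * (l * x)) := by gcongr
    _ = _ := by ring

lemma aux_log_sub (x : ℝ) (hx : 0 ≤ x) (hx1 : x < 1) :
    2 * x + 2 * x ^ 3 / 3 ≤ Real.log (1 + x) - Real.log (1 - x) := by
  have h := Real.hasSum_log_sub_log_of_abs_lt_one (by rw [abs_of_nonneg hx]; exact hx1)
  have := sum_le_hasSum (Finset.range 2) (fun i _ => by positivity) h
  simp [Finset.sum_range_succ] at this
  norm_num at this
  linarith

lemma aux_S (x : ℝ) (hx : 0 ≤ x) (hx1 : x < 1) :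
    x ^ 2 + x ^ 4 / 6 ≤ (1 + x) * Real.log (1 + x) + (1 - x) * Real.log (1 - x) := by
  have key : MonotoneOn (fun u : ℝ => (1 + u) * Real.log (1 + u) + (1 - u) * Real.log (1 - u)
      - (u ^ 2 + u ^ 4 / 6)) (Set.Ico 0 1) := by
    have hd : ∀ u ∈ Set.Ico (0:ℝ) 1, HasDerivAt (fun u : ℝ => (1 + u) * Real.log (1 + u)
      + (1 - u) * Real.log (1 - u) - (u ^ 2 + u ^ 4 / 6))
      (Real.log (1 + u) - Real.log (1 - u) - (2 * u + 2 * u ^ 3 / 3)) u := by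
      intro u hu
      have p1 : 1 + u ≠ 0 := by linarith [hu.1]
      have p2 : 1 - u ≠ 0 := by linarith [hu.2]
      have h1 : HasDerivAt (fun u : ℝ => 1 + u) 1 u := by
        simpa using (hasDerivAt_id u).const_add 1
      have h2 : HasDerivAt (fun u : ℝ => 1 - u) (-1) u := by
        simpa using (hasDerivAt_id u).const_sub 1
      have h3 : HasDerivAt (fun u : ℝ => u ^ 2 + u ^ 4 / 6) (2 * u + 2 * u ^ 3 / 3) u := by
        have := (hasDerivAt_pow 2 u).add ((hasDerivAt_pow 4 u).div_const 6)
        refine HasDerivAt.congr_deriv this ?_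
        norm_num; ring
      have := ((h1.mul (h1.log p1)).add (h2.mul (h2.log p2))).sub h3
      refine HasDerivAt.congr_deriv this ?_
      field_simp
      ring
    apply monotoneOn_of_deriv_nonneg (convex_Ico 0 1)
    · exact fun u hu => (hd u hu).continuousAt.continuousWithinAt
    · exact fun u hu => (hd u (interior_subset hu)).differentiableAt.differentiableWithinAt
    · intro u hu
      have hu' := interior_subset hu
      rw [(hd u hu').deriv]
      linarith [aux_log_sub u hu'.1 hu'.2]
  have := key (a := 0) ⟨le_rfl, one_pos⟩ (b := x) ⟨hx, hx1⟩ hx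
  simp at this
  linarith

lemma aux_H (a : ℝ) (ha : 0 < a) (ha1 : a ≤ 1 / 2) :
    Hent a ≤ Real.log 2 - (1 - 2 * a) ^ 2 / 2 - (1 - 2 * a) ^ 4 / 12 := by
  have h := aux_S (1 - 2 * a) (by linarith) (by linarith)
  have e1 : (1 + (1 - 2 * a)) = 2 * (1 - a) := by ring
  have e2 : (1 - (1 - 2 * a)) = 2 * a := by ring
  rw [e1, e2, Real.log_mul two_ne_zero (by linarith), Real.log_mul two_ne_zero ha.ne'] at h
  unfold Hent
  nlinarith

lemma aux_HkF (k : ℕ) (a c l : ℝ) (ha : 0 < a) (ha1 : a ≤ 1 / 2) (hl : 0 < l) :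
    HkF k a a (1 - a) c l
      = c * Hent a + (Real.log (1 + fEx (l * (1 - 2 * a)) / fEx l) - Real.log 2) := by
  have h := aux_f_pos l hl
  have h0 := aux_f_nonneg (l * (1 - 2 * a))
  unfold HkF
  rw [div_self ha.ne', div_self (by linarith : 1 - a ≠ 0)]
  have e : (fEx (l * (1 - a + a)) + fEx (l * (1 - a - a))) / (2 * fEx l)
      = (1 + fEx (l * (1 - 2 * a)) / fEx l) / 2 := by
    rw [show l * (1 - a + a) = l by ring, show l * (1 - a - a) = l * (1 - 2 * a) by ring]
    field_simp
  rw [e, Real.log_div (by positivity) two_ne_zero]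
  simp

lemma aux_log1p (q : ℝ) (hq : 0 ≤ q) : Real.log (1 + q) ≤ q := by
  have := Real.log_le_sub_one_of_pos (show 0 < 1 + q by linarith)
  linarith

/-- near region -/
lemma aux_near (k : ℕ) (hk : 4 ≤ k) (a c l : ℝ) (hc0 : 0 < c) (hc1 : c < 1) (ha : 1 / 4 ≤ a)
    (ha1 : a ≤ 1 / 2) (hl : 0 < l) (hpsi : psi l = c * k) :
    HkF k a a (1 - a) c l ≤ - min ((1 - c) / 2) (c / 1000) := by
  rw [aux_HkF k a c l (by linarith) ha1 hl]
  have hH := aux_H a (by linarith) ha1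
  set x := 1 - 2 * a with hx
  have hx0 : 0 ≤ x := by linarith
  have hx1 : x ≤ 1 / 2 := by linarith
  have hu : x ^ 2 ≤ 1 / 4 := by nlinarith
  have hu0 : 0 ≤ x ^ 2 := sq_nonneg x
  have hfp := aux_f_pos l hl
  have hf0 := aux_f_nonneg (l * x)
  set q := fEx (l * x) / fEx l with hq
  have hq0 : 0 ≤ q := by positivity
  have hlq := aux_log1p q hq0
  have hx4 : 0 ≤ x ^ 4 := by positivity
  have hH' : c * Hent a ≤ c * (Real.log 2 - x ^ 2 / 2) :=
    mul_le_mul_of_nonneg_left (by linarith) hc0.le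
  have l2 := Real.log_two_gt_d9
  have l2' := Real.log_two_lt_d9
  have hk' : (4:ℝ) ≤ k := by exact_mod_cast hk
  have hct : 4 * c ≤ psi l := by rw [hpsi]; nlinarith
  have hb : ∀ b : ℝ, 2 ≤ b → b ^ 2 / 4 ≤ (b - 1) + (b - 2) * (l / 2) → q ≤ 4 * x ^ 2 / b := by
    intro b hb1 hb2
    have h1 := aux_f_half b (l / 2) hb2
    have h2 := aux_f_scale (2 * x) (l / 2) (by linarith) (by linarith) (by linarith)
    rw [show 2 * x * (l / 2) = l * x by ring] at h2
    rw [show 2 * (l / 2) = l by ring] at h1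
    rw [hq, div_le_div_iff₀ hfp (by linarith)]
    nlinarith
  -- generic finishing
  have fin : ∀ C K : ℝ, c ≤ C → q ≤ K * x ^ 2 → C * Real.log 2 - Real.log 2 ≤ -(1 / 1000) →
      C * (Real.log 2 - 1 / 8) - Real.log 2 + K / 4 ≤ -(1 / 1000) →
      c * Hent a + (Real.log (1 + q) - Real.log 2) ≤ -min ((1 - c) / 2) (c / 1000) := by
    intro C K h1 h2 h3 h4
    have h5 : c * (Real.log 2 - x ^ 2 / 2) ≤ C * (Real.log 2 - x ^ 2 / 2) :=
      mul_le_mul_of_nonneg_right h1 (by linarith)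
    have h6 := min_le_right ((1 - c) / 2) (c / 1000)
    have h7 : C * (Real.log 2 - x ^ 2 / 2) - Real.log 2 + K * x ^ 2 ≤ -(1 / 1000) := by
      have i1 := mul_le_mul_of_nonneg_right h3 (show 0 ≤ 1 - 4 * x ^ 2 by linarith)
      have i2 := mul_le_mul_of_nonneg_right h4 (show 0 ≤ 4 * x ^ 2 by linarith)
      nlinarith
    linarith
  rcases le_or_gt 3 l with h3 | h3
  · have h1 := hb 8 (by norm_num) (by linarith)
    have h6 := min_le_left ((1 - c) / 2) (c / 1000)
    have : (1 - c) / 2 ≤ (1 - c) * (Real.log 2 - x ^ 2 / 2) := by nlinarith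
    nlinarith
  rcases le_or_gt (5 / 2) l with h4 | h4
  · have h1 := hb (25 / 4) (by norm_num) (by linarith)
    have h2 := aux_psi_le l (374 / 100) hl (by nlinarith [mul_nonneg (sub_nonneg.2 h4) (sub_nonneg.2 h3.le)])
    exact fin (374 / 400) (16 / 25) (by linarith) (by linarith) (by linarith) (by linarith)
  rcases le_or_gt 2 l with h5 | h5
  · have h1 := hb 6 (by norm_num) (by linarith)
    have h2 := aux_psi_le l (336 / 100) hl (by nlinarith [mul_nonneg (sub_nonneg.2 h5) (sub_nonneg.2 h4.le)])
    exact fin (336 / 400) (2 / 3) (by linarith) (by linarith) (by linarith) (by linarith)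
  · have h1 := aux_f_scale x l hx0 (by linarith) hl.le
    have hl2 : l ^ 2 ≤ 2 ^ 2 := pow_le_pow_left₀ hl.le h5.le 2
    have hl3 : l ^ 3 ≤ 2 ^ 3 := pow_le_pow_left₀ hl.le h5.le 3
    have hid : (3 - l) * (1 + l / 3 + l ^ 2 / 12) = 3 - l ^ 2 / 12 - l ^ 3 / 12 := by ring
    have h2 := aux_psi_le l 3 hl (by rw [hid]; linarith)
    refine fin (3 / 4) 1 (by linarith) ?_ (by linarith) (by linarith)
    rw [hq, div_le_iff₀ hfp, mul_comm l x]; linarith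

lemma aux_exp16 : Real.exp (-(8 / 5)) ≤ 0.20195 := by
  have h := Real.sum_le_exp_of_nonneg (show (0:ℝ) ≤ 2 / 5 by norm_num) 7
  simp [Finset.sum_range_succ, Nat.factorial] at h
  norm_num at h
  have e : Real.exp (8 / 5) = Real.exp (2 / 5) ^ 4 := by
    rw [← Real.exp_nat_mul]; norm_num
  have h2 : (1 / 0.20195 : ℝ) ≤ Real.exp (8 / 5) := by
    rw [e]
    refine le_trans ?_ (pow_le_pow_left₀ (by norm_num) h 4)
    norm_num
  rw [Real.exp_neg, inv_le_comm₀ (Real.exp_pos _) (by norm_num)]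
  norm_num at h2 ⊢
  exact h2

lemma aux_log12 : Real.log (6 / 5) ≤ 0.18233 := by
  rw [Real.log_le_iff_le_exp (by norm_num)]
  have h := Real.sum_le_exp_of_nonneg (show (0:ℝ) ≤ 0.18233 by norm_num) 6
  simp [Finset.sum_range_succ, Nat.factorial] at h
  refine le_trans ?_ h
  norm_num

lemma aux_mid (a w : ℝ) (ha : 0.168 ≤ a) (ha1 : a ≤ 1 / 4) (hw0 : 0 ≤ w)
    (hw : w ≤ Real.exp (-(8 * a))) :
    Hent a + (Real.log (1 + w) - Real.log 2) ≤ -(1 / 1000) := by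
  have hH := aux_H a (by linarith) (by linarith)
  obtain ⟨z, hz⟩ : ∃ z, z = 8 / 5 - 8 * a := ⟨_, rfl⟩
  have hx : 1 - 2 * a = 3 / 5 + z / 4 := by rw [hz]; ring
  rw [hx] at hH
  have hz1 : -(2 / 5) ≤ z := by linarith
  have hz2 : z ≤ 0.256 := by linarith
  have he := Real.exp_bound (x := z) (by rw [abs_le]; constructor <;> linarith) (n := 4) (by norm_num)
  simp [Finset.sum_range_succ, Nat.factorial] at he
  have he' := (abs_le.1 he).2
  rw [show |z| ^ 4 = z ^ 4 by rw [← abs_pow, abs_of_nonneg (by positivity)]] at he'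
  norm_num at he'
  have e1 : Real.exp (-(8 * a)) = Real.exp (-(8 / 5)) * Real.exp z := by
    rw [← Real.exp_add, hz]; ring_nf
  have hw2 : w ≤ 0.20195 * (1 + z + z ^ 2 / 2 + z ^ 3 / 6 + z ^ 4 * (5 / 96)) := by
    rw [e1] at hw
    refine hw.trans (mul_le_mul aux_exp16 (by linarith) (Real.exp_pos _).le (by norm_num))
  have hlog : Real.log (1 + w) ≤ 0.18233 + (w - 1 / 5) / (6 / 5) := by
    have h1 := Real.log_le_sub_one_of_pos (show 0 < (1 + w) / (6 / 5) by positivity)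
    rw [Real.log_div (by positivity) (by norm_num)] at h1
    have := aux_log12
    linarith
  have key : 0.18233 + (0.20195 * (1 + z + z ^ 2 / 2 + z ^ 3 / 6 + z ^ 4 * (5 / 96)) - 1 / 5) / (6 / 5)
      - (3 / 5 + z / 4) ^ 2 / 2 - (3 / 5 + z / 4) ^ 4 / 12 ≤ -(1 / 1000) := by
    rcases le_total z 0 with h | h
    · have a1 : 0 ≤ -z * (z + 2 / 5) := mul_nonneg (by linarith) (by linarith)
      have a2 := mul_nonneg a1 (sq_nonneg z)
      have a3 := mul_nonneg a1 (neg_nonneg.2 h)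
      nlinarith
    · have a1 : 0 ≤ z * (0.256 - z) := mul_nonneg (by linarith) (by linarith)
      have a2 := mul_nonneg a1 (sq_nonneg z)
      have a3 := mul_nonneg a1 h
      nlinarith
  linarith

lemma aux_small (a w : ℝ) (ha : 0 < a) (ha1 : a ≤ 0.169) (hw0 : 0 ≤ w)
    (hw : w ≤ 0.2) :
    Hent a + (Real.log (1 + w) - Real.log 2) ≤ -(1 / 1000) := by
  have hH := aux_H a ha (by linarith)
  have := aux_log1p w hw0
  have : 0 ≤ (1 - 2 * a) ^ 4 := by positivity
  nlinarith

lemma aux_alpha1 (k : ℕ) (hk : 4 ≤ k) (hk8 : k ≤ 8) : 0.168 ≤ 0.99 * alphaK k := by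
  have h1 : (1 / 16 : ℝ) ≤ (k : ℝ) ^ (-(k : ℝ) / ((k : ℝ) - 2)) := by
    have hk' : (4:ℝ) ≤ k := by exact_mod_cast hk
    have hp : (0:ℝ) < (k:ℝ) - 2 := by linarith
    rw [neg_div, Real.rpow_neg (by linarith), one_div]
    apply inv_anti₀ (by positivity)
    have h2 : (k:ℝ) ^ k ≤ 16 ^ (k - 2) := by
      interval_cases k <;> norm_num
    rw [div_eq_mul_inv, Real.rpow_mul (by linarith), Real.rpow_natCast,
      Real.rpow_inv_le_iff_of_pos (by positivity) (by norm_num) hp]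
    have : (k:ℝ) - 2 = ((k - 2 : ℕ) : ℝ) := by
      rw [Nat.cast_sub (by omega)]; norm_num
    rw [this, Real.rpow_natCast]
    exact h2
  have := Real.exp_one_gt_d9
  unfold alphaK
  nlinarith

lemma aux_alpha2 (k : ℕ) (hk : 8 ≤ k) : 1 ≤ 0.99 * alphaK k * k := by
  have hk' : (8:ℝ) ≤ k := by exact_mod_cast hk
  have h1 : (1 / 2 : ℝ) ≤ (k : ℝ) ^ (-(k : ℝ) / ((k : ℝ) - 2)) * k := by
    have hp : (0:ℝ) < (k:ℝ) - 2 := by linarith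
    have e : (k : ℝ) ^ (-(k : ℝ) / ((k : ℝ) - 2)) * k = ((k:ℝ) ^ ((2:ℝ) / ((k:ℝ) - 2)))⁻¹ := by
      rw [← Real.rpow_neg (by linarith), ← Real.rpow_add_one (by linarith)]
      congr 1; field_simp; ring
    rw [e, one_div]
    apply inv_anti₀ (by positivity)
    have h2 : (k:ℝ) ^ 2 ≤ 2 ^ (k - 2) := by
      obtain ⟨m, rfl⟩ := Nat.exists_eq_add_of_le hk
      have : ∀ m : ℕ, (8 + m) ^ 2 ≤ 2 ^ (6 + m) := by
        intro m
        induction m with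
        | zero => norm_num
        | succ n ih => rw [← add_assoc, ← add_assoc, pow_succ 2]; nlinarith [Nat.zero_le n, sq_nonneg n]
      have e : 8 + m - 2 = 6 + m := by omega
      rw [e]; exact_mod_cast this m
    rw [div_eq_mul_inv, Real.rpow_mul (by linarith), Real.rpow_two,
      Real.rpow_inv_le_iff_of_pos (by positivity) (by norm_num) hp]
    have : (k:ℝ) - 2 = ((k - 2 : ℕ) : ℝ) := by
      rw [Nat.cast_sub (by omega)]; norm_num
    rw [this, Real.rpow_natCast]
    exact h2
  have := Real.exp_one_gt_d9
  unfold alphaK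
  nlinarith

lemma aux_convex (w c : ℝ) (hw : 0 < w) (hc0 : 0 < c) (hc1 : c < 1) :
    Real.log (1 + w ^ c) - Real.log 2 ≤ c * (Real.log (1 + w) - Real.log 2) := by
  have h := (Real.concaveOn_rpow hc0.le hc1.le).2 (show (1:ℝ) ∈ Set.Ici 0 by simp)
    (show w ∈ Set.Ici 0 from hw.le)
    (show (0:ℝ) ≤ 1 / 2 by norm_num) (show (0:ℝ) ≤ 1 / 2 by norm_num) (by norm_num)
  simp only [smul_eq_mul, Real.one_rpow] at h
  have hw' : 0 < w ^ c := by positivity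
  rw [← Real.log_div (by positivity) two_ne_zero, ← Real.log_div (by positivity) two_ne_zero,
    ← Real.log_rpow (by positivity)]
  apply Real.log_le_log (by positivity)
  have e1 : (1 / 2 * 1 + 1 / 2 * w : ℝ) = (1 + w) / 2 := by ring
  rw [e1] at h
  linarith

lemma aux_far (k : ℕ) (hk : 4 ≤ k) (a c l : ℝ) (hc0 : 0 < c) (hc1 : c < 1) (ha0 : 0 < a)
    (hak : 0.99 * alphaK k ≤ a)
    (ha1 : a ≤ 1 / 4) (hl : 0 < l) (hpsi : psi l = c * k) :
    HkF k a a (1 - a) c l ≤ - (c / 1000) := by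
  rw [aux_HkF k a c l ha0 (by linarith) hl]
  have hk' : (4:ℝ) ≤ k := by exact_mod_cast hk
  have h1 := aux_f_exp l (1 - 2 * a) hl (by linarith) (by linarith)
  have hfp := aux_f_pos l hl
  have hf0 := aux_f_nonneg (l * (1 - 2 * a))
  set w := Real.exp (-(2 * a * k)) with hw
  have hw0 : 0 < w := Real.exp_pos _
  have hq : fEx (l * (1 - 2 * a)) / fEx l ≤ w ^ c := by
    rw [div_le_iff₀ hfp, hw, ← Real.exp_mul, mul_comm _ (fEx l)]
    refine h1.trans_eq ?_
    rw [hpsi]; congr 2; ring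
  have h2 : Real.log (1 + fEx (l * (1 - 2 * a)) / fEx l) ≤ Real.log (1 + w ^ c) :=
    Real.log_le_log (by positivity) (by linarith)
  have h3 := aux_convex w c hw0 hc0 hc1
  have h4 : Hent a + (Real.log (1 + w) - Real.log 2) ≤ -(1 / 1000) := by
    rcases le_or_gt 0.168 a with h | h
    · apply aux_mid a w h ha1 hw0.le
      rw [hw]; apply Real.exp_le_exp.2; nlinarith
    · apply aux_small a w ha0 (by linarith) hw0.le
      have hk8 : 8 ≤ k := by
        by_contra hh
        have := aux_alpha1 k hk (by omega)
        linarith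
      have h5 := aux_alpha2 k hk8
      have h6 : 1 ≤ a * k := h5.trans (mul_le_mul_of_nonneg_right hak (by linarith))
      have h7 : w ≤ Real.exp (-2) := by rw [hw]; apply Real.exp_le_exp.2; linarith
      have h8 : Real.exp (-2) ≤ Real.exp (-(8/5)) := Real.exp_le_exp.2 (by norm_num)
      have h9 : Real.exp (-2) ≤ 0.2 := by
        have e : Real.exp 2 = Real.exp 1 ^ 2 := by rw [← Real.exp_nat_mul]; norm_num
        have := Real.exp_one_gt_d9
        rw [Real.exp_neg, inv_le_comm₀ (Real.exp_pos _) (by norm_num), e]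
        norm_num
        nlinarith
      linarith
  have h5 := mul_le_mul_of_nonneg_left h4 hc0.le
  linarith

theorem Hk_middle_alpha (k : ℕ) (hk : 4 ≤ k) (c : ℝ) (hc : 2 / k < c) (hc1 : c < 1) :
    ∃ ε : ℝ, 0 < ε ∧
      ∀ a : ℝ, 0.99 * alphaK k ≤ a → a ≤ 1 / 2 →
      ∀ lam : ℝ, 0 < lam → psi lam = c * k →
        HkF k a a (1 - a) c lam ≤ -ε := by
  have hk' : (4:ℝ) ≤ k := by exact_mod_cast hk
  have hc0 : 0 < c := lt_trans (by positivity) hc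
  refine ⟨min ((1 - c) / 2) (c / 1000), lt_min (by linarith) (by linarith), ?_⟩
  intro a ha ha1 lam hl hpsi
  have hα : 0 < alphaK k := by unfold alphaK; positivity
  rcases le_or_gt (1 / 4) a with h | h
  · exact aux_near k hk a c lam hc0 hc1 h ha1 hl hpsi
  · have h1 := aux_far k hk a c lam hc0 hc1 (by linarith) ha h.le hl hpsi
    have := min_le_right ((1 - c) / 2) (c / 1000)
    linarith
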